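/- Let p ∈ 𝔻 \ {0}, let λ ∈ ℂ with |λ| = 1 and λp = conj(p), and let φ(z) = (az+b)/(cz+d) (a,b,c,d ∈ ℂ, ad−bc ≠ 0) be a linear fractional self-map of 𝔻 with φ(0) = 0. Then the composition operator C_φ on H² is JW_{ξ_p,τ_p}-normal if and only if C_φ is an isometry (equivalently, if and only if φ(z) = αz for some α ∈ ℂ with |α| = 1). -/

import Mathlib

open scoped ComplexConjugate InnerProductSpace ENNReal NNReal
open Complex Metric

noncomputable section

abbrev H2 : Type := lp (fun _ : ℕ => ℂ) 2

namespace H2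

/-- Evaluation of an element of `H²` (given by its sequence of Taylor coefficients)
at a point `z` of the unit disk: `f(z) = ∑ aₙ zⁿ`. -/
def eval (f : H2) (z : ℂ) : ℂ := ∑' n : ℕ, (f : ∀ _ : ℕ, ℂ) n * z ^ n

/-- The Szegő kernel function `K_w(z) = 1/(1 - conj w * z)`. -/
def ker (w z : ℂ) : ℂ := (1 - conj w * z)⁻¹

lemma kernel_memℓp (w : ℂ) (hw : ‖w‖ < 1) :
    Memℓp (fun n : ℕ => (conj w) ^ n) 2 := by
  apply memℓp_gen
  have hsum : Summable (fun n : ℕ => (‖w‖ ^ 2) ^ n) :=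
    summable_geometric_of_lt_one (by positivity) (by nlinarith [norm_nonneg w])
  refine hsum.congr fun n => ?_
  have h2 : ((2 : ℝ≥0∞).toReal) = ((2 : ℕ) : ℝ) := by simp
  rw [h2, Real.rpow_natCast]
  simp [norm_pow, ← pow_mul, Nat.mul_comm]

/-- The reproducing kernel of `H²` at `w` in the unit disk, as an element of `H²`. -/
def kernel (w : ℂ) : H2 :=
  if hw : ‖w‖ < 1 then ⟨fun n : ℕ => (conj w) ^ n, kernel_memℓp w hw⟩ else 0

/-- `T` is the composition operator `C_φ` on `H²`. -/
def IsCompOp (φ : ℂ → ℂ) (T : H2 →L[ℂ] H2) : Prop :=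
  ∀ f : H2, ∀ z : ℂ, ‖z‖ < 1 → eval (T f) z = eval f (φ z)

/-- `W` is the weighted composition operator `W_{ψ,φ}` on `H²`. -/
def IsWCompOp (ψ φ : ℂ → ℂ) (W : H2 →L[ℂ] H2) : Prop :=
  ∀ f : H2, ∀ z : ℂ, ‖z‖ < 1 → eval (W f) z = ψ z * eval f (φ z)

/-- A conjugation on `H²`: a conjugate-linear involution satisfying `⟪Cx, Cy⟫ = ⟪y, x⟫`. -/
structure IsConjugation (C : H2 → H2) : Prop where
  map_add : ∀ x y : H2, C (x + y) = C x + C y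
  map_smul : ∀ (c : ℂ) (x : H2), C (c • x) = conj c • C x
  invol : ∀ x : H2, C (C x) = x
  inner_conj : ∀ x y : H2, ⟪C x, C y⟫_ℂ = ⟪y, x⟫_ℂ

/-- `T` is `C`-normal: `C T* T C = T T*`. -/
def CNormal (C : H2 → H2) (T : H2 →L[ℂ] H2) : Prop :=
  ∀ x : H2, C ((ContinuousLinearMap.adjoint T) (T (C x)))
      = T ((ContinuousLinearMap.adjoint T) x)

/-- `T` is a normal operator: `T* T = T T*`. -/
def IsNormalOp (T : H2 →L[ℂ] H2) : Prop :=
  (ContinuousLinearMap.adjoint T).comp T = T.comp (ContinuousLinearMap.adjoint T)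

/-- `T` is a unitary operator. -/
def IsUnitaryOp (T : H2 →L[ℂ] H2) : Prop :=
  T.comp (ContinuousLinearMap.adjoint T) = ContinuousLinearMap.id ℂ H2 ∧
  (ContinuousLinearMap.adjoint T).comp T = ContinuousLinearMap.id ℂ H2

/-- `C` is the conjugation `J_μ` on `H²`: `(J_μ f)(z) = conj (f (μ * conj z))`. -/
def IsJmu (μ : ℂ) (C : H2 → H2) : Prop :=
  ∀ f : H2, ∀ z : ℂ, ‖z‖ < 1 → eval (C f) z = conj (eval f (μ * conj z))

/-- `ξ_p(z) = √(1-|p|²) / (1 - conj p * z)`. -/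
def xi (p z : ℂ) : ℂ := (Real.sqrt (1 - ‖p‖ ^ 2) : ℂ) / (1 - conj p * z)

/-- `τ_p(z) = λ (p - z) / (1 - conj p * z)`. -/
def tau (p lam z : ℂ) : ℂ := lam * (p - z) / (1 - conj p * z)

/-- `C` is the conjugation `J W_{ξ_p, τ_p}` on `H²`:
`(C f)(z) = conj (ξ_p(conj z) * f (τ_p (conj z)))`. -/
def IsJW (p lam : ℂ) (C : H2 → H2) : Prop :=
  ∀ f : H2, ∀ z : ℂ, ‖z‖ < 1 →
    eval (C f) z = conj (xi p (conj z) * eval f (tau p lam (conj z)))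

end H2

namespace H2

lemma hasSum_eval (f : H2) {z : ℂ} (hz : ‖z‖ < 1) :
    HasSum (fun n : ℕ => (f : ∀ _ : ℕ, ℂ) n * z ^ n) (eval f z) := by
  refine Summable.hasSum (Summable.of_norm_bounded
    ((summable_geometric_of_lt_one (norm_nonneg z) hz).mul_left ‖f‖) fun n => ?_)
  rw [norm_mul, norm_pow]
  gcongr
  exact lp.norm_apply_le_norm two_ne_zero f n

lemma hasFPowerSeriesAt_ofScalars {f : ℕ → ℂ} {F : ℂ → ℂ}
    (h : ∀ z : ℂ, ‖z‖ < 1 → HasSum (fun n : ℕ => f n * z ^ n) (F z)) :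
    HasFPowerSeriesAt F (FormalMultilinearSeries.ofScalars ℂ f) 0 := by
  have hball : HasFPowerSeriesOnBall F (FormalMultilinearSeries.ofScalars ℂ f) 0
      ((1 / 2 : ℝ≥0) : ℝ≥0∞) := by
    refine ⟨?_, by simp, fun {y} hy => ?_⟩
    · have h0 := (h (1 / 2) (by norm_num)).summable.tendsto_atTop_zero.norm
      refine FormalMultilinearSeries.le_radius_of_tendsto _ (l := ‖(0 : ℂ)‖) (h0.congr fun n => ?_)
      rw [FormalMultilinearSeries.ofScalars_norm]
      simp
    · have hy' : ‖y‖ < 1 := by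
        rw [Metric.eball_coe, mem_ball_zero_iff] at hy
        refine hy.trans ?_
        norm_num
      simpa [FormalMultilinearSeries.ofScalars_apply_eq, smul_eq_mul, mul_comm] using h y hy'
  exact hball.hasFPowerSeriesAt

/-- Taylor coefficients on the unit disk are determined by the function. -/
lemma coeff_eq_of_hasSum {f : H2} {g : ℕ → ℂ}
    (h : ∀ z : ℂ, ‖z‖ < 1 → HasSum (fun n : ℕ => g n * z ^ n) (eval f z)) :
    (f : ∀ _ : ℕ, ℂ) = g :=
  FormalMultilinearSeries.ofScalars_series_injective (𝕜 := ℂ) ℂ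
    ((hasFPowerSeriesAt_ofScalars fun _ hz => hasSum_eval f hz).eq_formalMultilinearSeries
      (hasFPowerSeriesAt_ofScalars h))

lemma ext_eval {f g : H2} (h : ∀ z : ℂ, ‖z‖ < 1 → eval f z = eval g z) : f = g :=
  lp.ext (coeff_eq_of_hasSum fun z hz => h z hz ▸ hasSum_eval g hz)

/-- The Taylor coefficients of `A + B z / (1 - u z)`. -/
def geomCoeff (A B u : ℂ) : ℕ → ℂ
  | 0 => A
  | n + 1 => B * u ^ n

lemma hasSum_geomCoeff (A B : ℂ) {u z : ℂ} (hu : ‖u‖ < 1) (hz : ‖z‖ < 1) :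
    HasSum (fun n : ℕ => geomCoeff A B u n * z ^ n) (A + B * z / (1 - u * z)) := by
  have huz : ‖u * z‖ < 1 := by
    rw [norm_mul]
    nlinarith [norm_nonneg u, norm_nonneg z]
  have h : HasSum (fun n : ℕ => geomCoeff A B u (n + 1) * z ^ (n + 1)) (B * z / (1 - u * z)) := by
    rw [div_eq_mul_inv]
    have hn : ∀ n : ℕ, geomCoeff A B u (n + 1) * z ^ (n + 1) = B * z * (u * z) ^ n := fun n => by
      simp only [geomCoeff]
      ring
    simp only [hn]
    exact (hasSum_geometric_of_norm_lt_one huz).mul_left (B * z)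
  have h' := HasSum.zero_add (f := fun n : ℕ => geomCoeff A B u n * z ^ n) h
  simpa only [geomCoeff, pow_zero, mul_one] using h'

lemma inner_of_geomCoeff {f g : H2} {A B u A' B' u' : ℂ} (hu : ‖u‖ < 1) (hu' : ‖u'‖ < 1)
    (hf : (f : ∀ _ : ℕ, ℂ) = geomCoeff A B u) (hg : (g : ∀ _ : ℕ, ℂ) = geomCoeff A' B' u') :
    ⟪f, g⟫_ℂ = conj A * A' + conj B * B' / (1 - conj u * u') := by
  have h := lp.hasSum_inner (𝕜 := ℂ) f g
  rw [hf, hg] at h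
  refine h.unique ?_
  have huz : ‖conj u * u'‖ < 1 := by
    rw [norm_mul, RCLike.norm_conj]
    nlinarith [norm_nonneg u, norm_nonneg u']
  have h : HasSum (fun n : ℕ => ⟪geomCoeff A B u (n + 1), geomCoeff A' B' u' (n + 1)⟫_ℂ)
      (conj B * B' / (1 - conj u * u')) := by
    rw [div_eq_mul_inv]
    have hn : ∀ n : ℕ, ⟪geomCoeff A B u (n + 1), geomCoeff A' B' u' (n + 1)⟫_ℂ =
        conj B * B' * (conj u * u') ^ n := fun n => by
      simp only [geomCoeff, RCLike.inner_apply, map_mul, map_pow]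
      ring
    simp only [hn]
    exact (hasSum_geometric_of_norm_lt_one huz).mul_left (conj B * B')
  have h' := HasSum.zero_add (f := fun n : ℕ => ⟪geomCoeff A B u n, geomCoeff A' B' u' n⟫_ℂ) h
  rwa [geomCoeff, geomCoeff, RCLike.inner_apply, mul_comm A'] at h'

lemma eval_single (k : ℕ) (z : ℂ) : eval (lp.single 2 k (1 : ℂ)) z = z ^ k := by
  rw [eval, tsum_eq_single k]
  · simp
  · intro n hn
    simp [Pi.single_eq_of_ne hn]

lemma eval_zero (f : H2) : eval f 0 = (f : ∀ _ : ℕ, ℂ) 0 := by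
  rw [eval, tsum_eq_single 0]
  · simp
  · intro n hn
    simp [hn]

lemma isCompOp_single_zero {φ : ℂ → ℂ} {T : H2 →L[ℂ] H2} (hT : IsCompOp φ T) :
    T (lp.single 2 0 (1 : ℂ)) = lp.single 2 0 (1 : ℂ) :=
  ext_eval fun z hz => by simp [hT _ z hz, eval_single]

lemma isCompOp_adjoint_single_zero {φ : ℂ → ℂ} {T : H2 →L[ℂ] H2} (hT : IsCompOp φ T)
    (hφ0 : φ 0 = 0) :
    ContinuousLinearMap.adjoint T (lp.single 2 0 (1 : ℂ)) = lp.single 2 0 (1 : ℂ) := by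
  refine ext_inner_right ℂ fun f => ?_
  rw [ContinuousLinearMap.adjoint_inner_left, lp.inner_single_left, lp.inner_single_left,
    ← eval_zero, ← eval_zero, hT f 0 (by simp), hφ0]

/-- Composition with a rotation multiplies the `n`-th Taylor coefficient by `α ^ n`. -/
lemma isCompOp_rotation_coeff {φ : ℂ → ℂ} {T : H2 →L[ℂ] H2} (hT : IsCompOp φ T) {α : ℂ}
    (hα : ‖α‖ = 1) (hφ : ∀ z : ℂ, ‖z‖ < 1 → φ z = α * z) (f : H2) :
    (T f : ∀ _ : ℕ, ℂ) = fun n => α ^ n * (f : ∀ _ : ℕ, ℂ) n := by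
  refine coeff_eq_of_hasSum fun z hz => ?_
  rw [hT f z hz, hφ z hz]
  convert hasSum_eval f (z := α * z) (by simpa [hα] using hz) using 2 with n
  rw [mul_pow]
  ring

lemma isCompOp_rotation_norm {φ : ℂ → ℂ} {T : H2 →L[ℂ] H2} (hT : IsCompOp φ T) {α : ℂ}
    (hα : ‖α‖ = 1) (hφ : ∀ z : ℂ, ‖z‖ < 1 → φ z = α * z) (f : H2) : ‖T f‖ = ‖f‖ := by
  rw [lp.norm_eq_tsum_rpow (by simp), lp.norm_eq_tsum_rpow (by simp),
    isCompOp_rotation_coeff hT hα hφ f]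
  simp [hα]

lemma isCompOp_rotation_surjective {φ : ℂ → ℂ} {T : H2 →L[ℂ] H2} (hT : IsCompOp φ T) {α : ℂ}
    (hα : ‖α‖ = 1) (hφ : ∀ z : ℂ, ‖z‖ < 1 → φ z = α * z) : Function.Surjective T := by
  intro f
  have hmem : Memℓp (fun n : ℕ => α⁻¹ ^ n * (f : ∀ _ : ℕ, ℂ) n) 2 :=
    (lp.memℓp f).mono' fun n => by simp [hα]
  refine ⟨⟨_, hmem⟩, lp.ext ?_⟩
  rw [isCompOp_rotation_coeff hT hα hφ]
  funext n
  have h0 : α ≠ 0 := norm_ne_zero_iff.1 (by simp [hα])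
  simp [h0]

lemma adjoint_comp_self_of_isometry {T : H2 →L[ℂ] H2} (h : ∀ f, ‖T f‖ = ‖f‖) (f : H2) :
    ContinuousLinearMap.adjoint T (T f) = f := by
  have := (ContinuousLinearMap.norm_map_iff_adjoint_comp_self T).1 h
  exact DFunLike.congr_fun this f

lemma cnormal_of_isometry_of_surjective {C : H2 → H2} (hC : IsConjugation C) {T : H2 →L[ℂ] H2}
    (h : ∀ f, ‖T f‖ = ‖f‖) (hs : Function.Surjective T) : CNormal C T := by
  intro x
  obtain ⟨y, rfl⟩ := hs x
  rw [adjoint_comp_self_of_isometry h, adjoint_comp_self_of_isometry h, hC.invol]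

lemma exists_norm_eq_one_mul_eq_neg_norm (γ : ℂ) : ∃ v : ℂ, ‖v‖ = 1 ∧ γ * v = -(‖γ‖ : ℂ) := by
  by_cases h : γ = 0
  · exact ⟨1, by simp, by simp [h]⟩
  · have h' : (‖γ‖ : ℂ) ≠ 0 := by simpa using h
    refine ⟨-(‖γ‖ : ℂ) / γ, ?_, by field_simp⟩
    simp [h]

lemma norm_add_norm_le_one_of_selfMap {α γ : ℂ} (hden : ∀ z : ℂ, ‖z‖ < 1 → 1 + γ * z ≠ 0)
    (hself : ∀ z : ℂ, ‖z‖ < 1 → ‖α * z / (1 + γ * z)‖ < 1) : ‖α‖ + ‖γ‖ ≤ 1 := by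
  have hγ : ‖γ‖ ≤ 1 := by
    by_contra! h
    have h0 : γ ≠ 0 := norm_pos_iff.1 (by linarith)
    refine hden (-γ⁻¹) ?_ (by field_simp; simp)
    rw [norm_neg, norm_inv]
    exact inv_lt_one_of_one_lt₀ h
  by_contra! h
  obtain ⟨v, hv, hγv⟩ := exists_norm_eq_one_mul_eq_neg_norm γ
  set r : ℝ := (‖α‖ + ‖γ‖)⁻¹ with hr
  have hr0 : 0 < r := by positivity
  have hr1 : r < 1 := inv_lt_one_of_one_lt₀ h
  have hz : ‖(r : ℂ) * v‖ = r := by simp [hv, abs_of_pos hr0]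
  have h1 := hself (r * v) (by rw [hz]; exact hr1)
  have h2 : 1 + γ * (r * v) = ((1 - ‖γ‖ * r : ℝ) : ℂ) := by
    push_cast
    linear_combination (r : ℂ) * hγv
  have h3 : 0 < 1 - ‖γ‖ * r := by nlinarith [norm_nonneg γ]
  rw [norm_div, norm_mul, hz, h2, Complex.norm_real, Real.norm_of_nonneg h3.le,
    div_lt_one h3] at h1
  have h4 : (‖α‖ + ‖γ‖) * r = 1 := mul_inv_cancel₀ (by positivity)
  linarith

section LinearFractional

variable {α γ : ℂ} {φ : ℂ → ℂ} {T : H2 →L[ℂ] H2}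

lemma isCompOp_single_one_coeff (hγ : ‖γ‖ < 1)
    (hφ : ∀ z : ℂ, ‖z‖ < 1 → φ z = α * z / (1 + γ * z)) (hT : IsCompOp φ T) :
    (T (lp.single 2 1 (1 : ℂ)) : ∀ _ : ℕ, ℂ) = geomCoeff 0 α (-γ) := by
  refine coeff_eq_of_hasSum fun z hz => ?_
  rw [hT _ z hz, eval_single, hφ z hz]
  simpa using hasSum_geomCoeff 0 α (u := -γ) (by simpa using hγ) hz

lemma selfMap_eq_rotation_of_isometry (hα : α ≠ 0) (hle : ‖α‖ + ‖γ‖ ≤ 1)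
    (hφ : ∀ z : ℂ, ‖z‖ < 1 → φ z = α * z / (1 + γ * z)) (hT : IsCompOp φ T)
    (h : ∀ f : H2, ‖T f‖ = ‖f‖) : γ = 0 ∧ ‖α‖ = 1 := by
  have hα' : 0 < ‖α‖ := norm_pos_iff.2 hα
  have hγ : ‖γ‖ < 1 := by linarith
  have hc := isCompOp_single_one_coeff hγ hφ hT
  have hin := inner_of_geomCoeff (by simpa using hγ) (by simpa using hγ) hc hc
  have hadj : ⟪T (lp.single 2 1 (1 : ℂ)), T (lp.single 2 1 (1 : ℂ))⟫_ℂ = 1 := by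
    rw [inner_self_eq_norm_sq_to_K, h, ← inner_self_eq_norm_sq_to_K, lp.inner_single_left]
    simp
  have hne : 1 - ‖γ‖ ^ 2 ≠ 0 := by nlinarith [norm_nonneg γ]
  have hreal : ‖α‖ ^ 2 / (1 - ‖γ‖ ^ 2) = 1 := by
    rw [hadj] at hin
    simp only [map_zero, zero_mul, zero_add, map_neg, neg_mul_neg, Complex.conj_mul'] at hin
    exact_mod_cast hin.symm
  rw [div_eq_one_iff_eq hne] at hreal
  have hγ0 : ‖γ‖ = 0 := by nlinarith [norm_nonneg γ]
  refine ⟨norm_eq_zero.1 hγ0, ?_⟩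
  nlinarith

/-- `C`-normality forces `T* T` to fix `C 1`, a nonconstant multiple of a reproducing kernel, and
pairing this identity with the monomial `z` shows that the symbol is a rotation. -/
lemma selfMap_eq_rotation_of_cnormal {p lam : ℂ} (hp : ‖p‖ < 1) (hp0 : p ≠ 0)
    {C : H2 → H2} (hC : IsConjugation C) (hCJ : IsJW p lam C)
    (hα : α ≠ 0) (hden : ∀ z : ℂ, ‖z‖ < 1 → 1 + γ * z ≠ 0)
    (hself : ∀ z : ℂ, ‖z‖ < 1 → ‖φ z‖ < 1) (hle : ‖α‖ + ‖γ‖ ≤ 1)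
    (hφ : ∀ z : ℂ, ‖z‖ < 1 → φ z = α * z / (1 + γ * z)) (hT : IsCompOp φ T)
    (h : CNormal C T) : γ = 0 ∧ ‖α‖ = 1 := by
  have hα' : 0 < ‖α‖ := norm_pos_iff.2 hα
  have hγ0 := norm_nonneg γ
  have hγ : ‖γ‖ < 1 := by linarith
  have hφ0 : φ 0 = 0 := by simp [hφ 0 (by simp)]
  set s : ℂ := (Real.sqrt (1 - ‖p‖ ^ 2) : ℂ) with hs
  have hs0 : s ≠ 0 := by
    rw [hs]
    exact_mod_cast (Real.sqrt_pos.2 (by nlinarith [norm_nonneg p])).ne'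
  have hsc : conj s = s := Complex.conj_ofReal _
  set k : H2 := C (lp.single 2 0 (1 : ℂ)) with hk
  have hpz : ∀ z : ℂ, ‖z‖ < 1 → 1 - p * z ≠ 0 := fun z hz h0 => by
    have : ‖p * z‖ = 1 := by rw [← sub_eq_zero.1 h0, norm_one]
    rw [norm_mul] at this
    nlinarith [norm_nonneg p, norm_nonneg z]
  have hkeval : ∀ z : ℂ, ‖z‖ < 1 → eval k z = s + s * p * z / (1 - p * z) := fun z hz => by
    have := hpz z hz
    rw [hk, hCJ _ z hz, eval_single]
    simp only [xi, pow_zero, mul_one, map_div₀, map_sub, map_one, map_mul, Complex.conj_conj, ← hs, hsc]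
    field_simp
    ring
  have hkcoeff : (k : ∀ _ : ℕ, ℂ) = geomCoeff s (s * p) p :=
    coeff_eq_of_hasSum fun z hz => by
      rw [hkeval z hz]
      exact hasSum_geomCoeff _ _ hp hz
  have hu : ‖p * α - γ‖ < 1 := by
    refine (norm_sub_le _ _).trans_lt ?_
    rw [norm_mul]
    nlinarith
  have hTk : (T k : ∀ _ : ℕ, ℂ) = geomCoeff s (s * p * α) (p * α - γ) :=
    coeff_eq_of_hasSum fun z hz => by
      rw [hT _ z hz, hkeval _ (hself z hz)]
      convert hasSum_geomCoeff s (s * p * α) hu hz using 2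
      have h1 := hden z hz
      have h2 := hpz _ (hself z hz)
      rw [hφ z hz] at h2 ⊢
      generalize hD : 1 + γ * z = D at h1 h2 ⊢
      have h3 : 1 - (p * α - γ) * z = D - p * α * z := by
        rw [← hD]
        ring
      have h4 : 1 - p * (α * z / D) = (D - p * α * z) / D := by
        field_simp
      rw [h4, div_ne_zero_iff] at h2
      rw [h3, h4]
      have := h2.1
      field_simp
  have hfix : ContinuousLinearMap.adjoint T (T k) = k := by
    have := h (lp.single 2 0 (1 : ℂ))
    rw [isCompOp_adjoint_single_zero hT hφ0, isCompOp_single_zero hT, ← hk] at this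
    exact (hC.invol _).symm.trans (congrArg C this)
  have hin := inner_of_geomCoeff (by simpa using hγ) hu (isCompOp_single_one_coeff hγ hφ hT) hTk
  rw [← ContinuousLinearMap.adjoint_inner_right, hfix, lp.inner_single_left, hkcoeff] at hin
  have hne : 1 - conj (-γ) * (p * α - γ) ≠ 0 := by
    intro h0
    have h1 : ‖conj (-γ) * (p * α - γ)‖ = 1 := by rw [← sub_eq_zero.1 h0, norm_one]
    rw [norm_mul, RCLike.norm_conj, norm_neg] at h1
    nlinarith [norm_nonneg (p * α - γ)]
  simp only [geomCoeff, pow_zero, mul_one, RCLike.inner_apply, map_one, map_zero, zero_mul,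
    zero_add] at hin
  rw [eq_div_iff hne] at hin
  have hkey : ((1 - ‖γ‖ ^ 2 : ℝ) : ℂ) = ((‖α‖ ^ 2 : ℝ) : ℂ) - conj γ * p * α := by
    push_cast
    rw [← Complex.conj_mul', ← Complex.conj_mul']
    apply mul_left_cancel₀ (mul_ne_zero hs0 hp0)
    rw [map_neg] at hin
    linear_combination hin
  have hnorm : 1 - ‖γ‖ ^ 2 ≤ ‖α‖ ^ 2 + ‖γ‖ * ‖p‖ * ‖α‖ := by
    have h1 := congrArg norm hkey
    have h2 := norm_sub_le ((‖α‖ ^ 2 : ℝ) : ℂ) (conj γ * p * α)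
    rw [← h1, Complex.norm_real, Complex.norm_real, norm_mul, norm_mul, RCLike.norm_conj,
      Real.norm_of_nonneg (sq_nonneg _)] at h2
    exact (Real.le_norm_self _).trans h2
  have hγz : ‖γ‖ = 0 := by
    have h1 : ‖α‖ ^ 2 ≤ (1 - ‖γ‖) ^ 2 := by nlinarith
    have h2 : ‖γ‖ * ‖p‖ * ‖α‖ ≤ ‖γ‖ * ‖p‖ * (1 - ‖γ‖) := by
      gcongr
      linarith
    have h3 : 0 ≤ (1 - ‖γ‖) * (‖γ‖ * ‖p‖ - 2 * ‖γ‖) := by nlinarith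
    have h4 := nonneg_of_mul_nonneg_right h3 (by linarith : 0 < 1 - ‖γ‖)
    nlinarith
  refine ⟨norm_eq_zero.1 hγz, ?_⟩
  rw [hγz] at hnorm hle
  nlinarith

end LinearFractional

end H2

/-- Let `φ` be a linear fractional self-map of `𝔻` with `φ(0) = 0`. Then `C_φ` is
`J W_{ξ_p,τ_p}`-normal iff `C_φ` is an isometry (equivalently, iff `φ(z) = αz`, `|α| = 1`). -/
theorem stmt4 (p lam a b c d : ℂ)
    (hp : ‖p‖ < 1) (hp0 : p ≠ 0) (hlam : ‖lam‖ = 1) (hlp : lam * p = conj p)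
    (φ : ℂ → ℂ) (hφ : ∀ z : ℂ, φ z = (a * z + b) / (c * z + d))
    (hdet : a * d - b * c ≠ 0)
    (hden : ∀ z : ℂ, ‖z‖ < 1 → c * z + d ≠ 0)
    (hself : ∀ z : ℂ, ‖z‖ < 1 → ‖φ z‖ < 1)
    (hφ0 : φ 0 = 0)
    (T : H2 →L[ℂ] H2) (hT : H2.IsCompOp φ T)
    (C : H2 → H2) (hC : H2.IsConjugation C) (hCJ : H2.IsJW p lam C) :
    (H2.CNormal C T ↔ ∀ f : H2, ‖T f‖ = ‖f‖) ∧
      ((∀ f : H2, ‖T f‖ = ‖f‖) ↔ ∃ α : ℂ, ‖α‖ = 1 ∧ ∀ z : ℂ, ‖z‖ < 1 → φ z = α * z) := by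
  have hd : d ≠ 0 := by simpa using hden 0 (by simp)
  have hb : b = 0 := by simpa [hφ, hd] using hφ0
  subst hb
  have ha : a ≠ 0 := by
    rintro rfl
    simp at hdet
  have hα : a / d ≠ 0 := div_ne_zero ha hd
  have hden' : ∀ z : ℂ, ‖z‖ < 1 → 1 + c / d * z ≠ 0 := fun z hz h0 => by
    apply hden z hz
    field_simp at h0
    linear_combination h0
  have hφ' : ∀ z : ℂ, ‖z‖ < 1 → φ z = a / d * z / (1 + c / d * z) := fun z hz => by
    have h1 := hden z hz
    have h2 : 1 + c / d * z = (c * z + d) / d := by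
      field_simp
      ring
    rw [hφ, h2]
    field_simp
    simp
  have hle := H2.norm_add_norm_le_one_of_selfMap hden' fun z hz => hφ' z hz ▸ hself z hz
  have hrot : c / d = 0 ∧ ‖a / d‖ = 1 →
      ∃ α : ℂ, ‖α‖ = 1 ∧ ∀ z : ℂ, ‖z‖ < 1 → φ z = α * z := fun ⟨h0, h1⟩ =>
    ⟨a / d, h1, fun z hz => by simp [hφ' z hz, h0]⟩
  have hiso : (∀ f : H2, ‖T f‖ = ‖f‖) ↔ ∃ α : ℂ, ‖α‖ = 1 ∧ ∀ z : ℂ, ‖z‖ < 1 → φ z = α * z :=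
    ⟨fun h => hrot (H2.selfMap_eq_rotation_of_isometry hα hle hφ' hT h),
      fun ⟨_, h1, h2⟩ => H2.isCompOp_rotation_norm hT h1 h2⟩
  refine ⟨⟨fun h => hiso.2 (hrot (H2.selfMap_eq_rotation_of_cnormal hp hp0 hC hCJ hα hden' hself
    hle hφ' hT h)), fun h => ?_⟩, hiso⟩
  obtain ⟨α, h1, h2⟩ := hiso.1 h
  exact H2.cnormal_of_isometry_of_surjective hC h (H2.isCompOp_rotation_surjective hT h1 h2)
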